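/- Let $n, r, k_1, \ldots, k_r, t$ be positive integers with $r \ge 2$, $k_1 \ge k_2 \ge \cdots \ge k_r \ge t$, and $n \ge k_1 + k_2 + t + 1$. Let $V$ be an $n$-dimensional vector space over $\mathbb{F}_q$. If $\mathcal{F}_i \subseteq {V \brack k_i}$ for $1 \le i \le r$ are $r$-cross $t$-intersecting families, then $\prod_{i=1}^r |\mathcal{F}_i| \le \prod_{i=1}^r {n-t \brack k_i - t}_q$. -/

import Mathlib

/-- Gaussian binomial coefficient defined by the product formula. -/
noncomputable def gaussBinom (q a b : ℕ) : ℚ :=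
  ∏ i ∈ Finset.range b, ((q : ℚ) ^ (a - i) - 1) / ((q : ℚ) ^ (b - i) - 1)

section Helpers

open Module Classical

theorem aux_exists_sub {F : Type*} [Field F] {V : Type*} [AddCommGroup V] [Module F V]
    [FiniteDimensional F V] (S : Submodule F V) (d : ℕ) (h : d ≤ finrank F S) :
    ∃ T ≤ S, finrank F T = d := by
  obtain ⟨f, hf⟩ := exists_linearIndependent_of_le_finrank h
  have hf2 : LinearIndependent F (fun i => (f i : V)) :=
    hf.map' S.subtype (Submodule.ker_subtype S)
  refine ⟨Submodule.span F (Set.range fun i => (f i : V)), ?_, ?_⟩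
  · rw [Submodule.span_le]
    rintro _ ⟨i, rfl⟩
    exact (f i).2
  · rw [finrank_span_eq_card hf2]; simp

theorem aux_card_diff {F : Type*} [Field F] [Fintype F] {V : Type*} [AddCommGroup V] [Module F V]
    [FiniteDimensional F V] [Fintype V] (A B : Submodule F V) (h : A ≤ B) :
    (((Finset.univ.filter fun v : V => v ∈ B ∧ v ∉ A).card : ℕ) : ℚ)
      = (Fintype.card F : ℚ) ^ finrank F B - (Fintype.card F : ℚ) ^ finrank F A := by
  have key : ∀ C : Submodule F V, (Finset.univ.filter fun v : V => v ∈ C).card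
      = Fintype.card F ^ finrank F C := by
    intro C
    rw [← Module.card_eq_pow_finrank (K := F) (V := C), Fintype.card_subtype]
  have e : (Finset.univ.filter fun v : V => v ∈ B ∧ v ∉ A)
      = (Finset.univ.filter fun v : V => v ∈ B) \ (Finset.univ.filter fun v : V => v ∈ A) := by
    ext v; simp
  have hs : (Finset.univ.filter fun v : V => v ∈ A) ⊆ (Finset.univ.filter fun v : V => v ∈ B) := by
    intro v; simp only [Finset.mem_filter, Finset.mem_univ, true_and]; exact fun hv => h hv
  rw [e, Finset.card_sdiff_of_subset hs, Nat.cast_sub (Finset.card_le_card hs), key, key]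
  push_cast; rfl

theorem aux_double {α β : Type*} (X : Finset α) (Y : Finset β) (R : α → β → Prop) (m D : ℚ)
    (h1 : ∀ a ∈ X, m ≤ ((Y.filter fun b => R a b).card : ℚ))
    (h2 : ∀ b ∈ Y, ((X.filter fun a => R a b).card : ℚ) ≤ D) :
    (X.card : ℚ) * m ≤ (Y.card : ℚ) * D := by
  have := Finset.card_nsmul_le_card_nsmul (s := X) (t := Y) (m := m) (n := D) R h1 h2
  simpa [nsmul_eq_mul] using this

theorem aux_gauss_rec (q n k d : ℕ) (hd : d < k) :
    gaussBinom q (n - d) (k - d) =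
      ((q : ℚ) ^ (n - d) - 1) / ((q : ℚ) ^ (k - d) - 1) * gaussBinom q (n - (d + 1)) (k - (d + 1)) := by
  unfold gaussBinom
  obtain ⟨j, hj⟩ : ∃ j, k - d = j + 1 := ⟨k - d - 1, by omega⟩
  have hj2 : k - (d + 1) = j := by omega
  rw [hj, hj2, Finset.prod_range_succ', mul_comm]
  congr 1
  apply Finset.prod_congr rfl
  intro i _
  rw [show n - d - (i + 1) = n - (d + 1) - i by omega, show j + 1 - (i + 1) = j - i by omega]

theorem aux_gauss_nonneg (q a b : ℕ) (hq : 1 ≤ q) : 0 ≤ gaussBinom q a b := by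
  unfold gaussBinom
  apply Finset.prod_nonneg
  intro i _
  have hq' : (1 : ℚ) ≤ q := by exact_mod_cast hq
  exact div_nonneg (sub_nonneg.2 (one_le_pow₀ hq')) (sub_nonneg.2 (one_le_pow₀ hq'))

variable {F : Type*} [Field F] [Fintype F] {V : Type*} [AddCommGroup V] [Module F V]
    [FiniteDimensional F V]

theorem aux_one_lt : (1 : ℚ) < (Fintype.card F : ℚ) := by
  exact_mod_cast Fintype.one_lt_card

theorem aux_deg [Fintype V] (𝓕 : Finset (Submodule F V)) (k : ℕ)
    (hk : ∀ W ∈ 𝓕, finrank F W = k) (hkn : k ≤ finrank F V) (j : ℕ) :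
    ∀ (d : ℕ) (A : Submodule F V), finrank F A = d → d + j = k →
    ((𝓕.filter fun W => A ≤ W).card : ℚ) ≤
      gaussBinom (Fintype.card F) (finrank F V - d) (k - d) := by
  have hq := aux_one_lt (F := F)
  induction j with
  | zero =>
    intro d A hA hd
    have : k - d = 0 := by omega
    rw [this]
    simp only [gaussBinom, Finset.range_zero, Finset.prod_empty]
    have : (𝓕.filter fun W => A ≤ W).card ≤ 1 := by
      rw [Finset.card_le_one]
      intro a ha b hb
      simp only [Finset.mem_filter] at ha hb
      rw [← Submodule.eq_of_le_of_finrank_eq ha.2 (by rw [hA, hk a ha.1]; omega),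
        ← Submodule.eq_of_le_of_finrank_eq hb.2 (by rw [hA, hk b hb.1]; omega)]
    exact_mod_cast this
  | succ j ih =>
    intro d A hA hd
    rw [aux_gauss_rec _ _ _ _ (by omega)]
    set q : ℚ := (Fintype.card F : ℚ) with hqdef
    set g := gaussBinom (Fintype.card F) (finrank F V - (d + 1)) (k - (d + 1))
    have h := aux_double (𝓕.filter fun W => A ≤ W)
      (Finset.univ.filter fun v : V => v ∈ (⊤ : Submodule F V) ∧ v ∉ A)
      (fun W v => v ∈ W) (q ^ k - q ^ d) g ?_ ?_
    · rw [aux_card_diff A ⊤ le_top, finrank_top, hA] at h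
      have e1 : q ^ k - q ^ d = q ^ d * (q ^ (k - d) - 1) := by
        rw [mul_sub, ← pow_add]; congr 2 <;> [omega; ring]
      have e2 : q ^ finrank F V - q ^ d = q ^ d * (q ^ (finrank F V - d) - 1) := by
        rw [mul_sub, ← pow_add]; congr 2 <;> [omega; ring]
      rw [← hqdef, e1, e2] at h
      have hp : 0 < q ^ d := by positivity
      have hp2 : 0 < q ^ (k - d) - 1 := sub_pos.2 (one_lt_pow₀ hq (by omega))
      rw [div_mul_eq_mul_div, le_div_iff₀ hp2]
      refine le_of_mul_le_mul_left ?_ hp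
      linarith
    · intro W hW
      simp only [Finset.mem_filter] at hW
      have := aux_card_diff A W hW.2
      rw [hA, hk W hW.1] at this
      rw [← this, Finset.filter_filter]
      apply le_of_eq
      congr 2
      ext v; simp; tauto
    · intro v hv
      simp only [Finset.mem_filter, Finset.mem_univ, true_and, Submodule.mem_top] at hv
      refine le_trans ?_ (ih (d + 1) (A ⊔ Submodule.span F {v}) ?_ (by omega))
      · norm_cast
        apply Finset.card_le_card
        intro W
        simp only [Finset.mem_filter, sup_le_iff, Submodule.span_singleton_le_iff_mem]
        tauto
      · rw [Submodule.finrank_sup_span_singleton hv, hA]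

theorem aux_branch [Fintype V] (𝓕 𝓖 : Finset (Submodule F V)) (l t s : ℕ) (D : ℚ)
    (ht : 1 ≤ t) (htl : t ≤ l)
    (hl : ∀ W ∈ 𝓖, finrank F W = l)
    (hx : ∀ A ∈ 𝓕, ∀ B ∈ 𝓖, t ≤ finrank F ↥(A ⊓ B))
    (hs : ∀ A : Submodule F V, finrank F A < s → ∃ G ∈ 𝓖, finrank F ↥(A ⊓ G) < t)
    (hD : ∀ A : Submodule F V, finrank F A = s → ((𝓕.filter fun W => A ≤ W).card : ℚ) ≤ D)
    (j : ℕ) :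
    ∀ (d : ℕ) (A : Submodule F V), finrank F A = d → d + j = s →
    ((𝓕.filter fun W => A ≤ W).card : ℚ) ≤
      ((((Fintype.card F : ℚ) ^ (l - t + 1) - 1)) / ((Fintype.card F : ℚ) - 1)) ^ j * D := by
  have hq := aux_one_lt (F := F)
  induction j with
  | zero =>
    intro d A hA hd
    simpa using hD A (by omega)
  | succ j ih =>
    intro d A hA hd
    obtain ⟨G, hG, hGt⟩ := hs A (by omega)
    obtain ⟨C, hC⟩ := Submodule.exists_isCompl (A ⊓ G)
    have hm : (A ⊓ G) ⊔ (C ⊓ G) = G := by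
      rw [← sup_inf_assoc_of_le C (inf_le_right : A ⊓ G ≤ G), hC.sup_eq_top, top_inf_eq]
    have hi : (A ⊓ G) ⊓ (C ⊓ G) = ⊥ := by
      rw [← inf_assoc, hC.inf_eq_bot, bot_inf_eq]
    have hdm := Submodule.finrank_sup_add_finrank_inf_eq (A ⊓ G) (C ⊓ G)
    rw [hm, hi, finrank_bot, hl G hG] at hdm
    obtain ⟨H, hHC, hH⟩ := aux_exists_sub (C ⊓ G) (l - t + 1) (by omega)
    have hHA : ∀ v ∈ H, v ∈ A → v = 0 := by
      intro v hv hvA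
      have : v ∈ (A ⊓ G) ⊓ (C ⊓ G) := ⟨⟨hvA, (hHC hv).2⟩, hHC hv⟩
      rwa [hi, Submodule.mem_bot] at this
    set q : ℚ := (Fintype.card F : ℚ) with hqdef
    set L := (q ^ (l - t + 1) - 1) / (q - 1) with hL
    have h := aux_double (𝓕.filter fun W => A ≤ W)
      (Finset.univ.filter fun v : V => v ∈ H ∧ v ∉ (⊥ : Submodule F V))
      (fun W v => v ∈ W) (q - 1) (L ^ j * D) ?_ ?_
    · rw [aux_card_diff ⊥ H bot_le, finrank_bot, hH, ← hqdef, pow_zero] at h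
      rw [pow_succ, mul_assoc, mul_comm L, ← mul_assoc, hL, ← mul_div_assoc,
        le_div_iff₀ (by linarith)]
      linarith
    · intro W hW
      simp only [Finset.mem_filter] at hW
      have h1 := hx W hW.1 G hG
      have h2 := Submodule.finrank_sup_add_finrank_inf_eq (W ⊓ G) H
      have h3 : finrank F ↥((W ⊓ G) ⊔ H) ≤ l := by
        rw [← hl G hG]
        exact Submodule.finrank_mono (sup_le inf_le_right (hHC.trans inf_le_right))
      have h4 : finrank F ↥((W ⊓ G) ⊓ H) ≤ finrank F ↥(W ⊓ H) :=
        Submodule.finrank_mono (inf_le_inf_right _ inf_le_left)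
      have h5 : 1 ≤ finrank F ↥(W ⊓ H) := by omega
      have := aux_card_diff ⊥ (W ⊓ H) bot_le
      rw [finrank_bot, pow_zero] at this
      calc q - 1 ≤ q ^ finrank F ↥(W ⊓ H) - 1 := by
            have := pow_le_pow_right₀ hq.le h5
            rw [pow_one] at this
            linarith
        _ = _ := this.symm
        _ = _ := by
          rw [Finset.filter_filter]
          congr 2
          ext v; simp; tauto
    · intro v hv
      simp only [Finset.mem_filter, Finset.mem_univ, true_and, Submodule.mem_bot] at hv
      have hvA : v ∉ A := fun h => hv.2 (hHA v hv.1 h)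
      refine le_trans ?_ (ih (d + 1) (A ⊔ Submodule.span F {v}) ?_ (by omega))
      · norm_cast
        apply Finset.card_le_card
        intro W
        simp only [Finset.mem_filter, sup_le_iff, Submodule.span_singleton_le_iff_mem]
        tauto
      · rw [Submodule.finrank_sup_span_singleton hvA, hA]

theorem aux_ratio (q : ℚ) (hq : 1 < q) (t j : ℕ) :
    (q ^ (t + (j + 1)) - 1) * (q - 1) ≤ (q ^ (t + 1) - 1) * (q ^ (j + 1) - 1) := by
  have h1 : 1 ≤ q ^ t := one_le_pow₀ hq.le
  have h2 : 1 ≤ q ^ j := one_le_pow₀ hq.le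
  have : (q ^ (t + 1) - 1) * (q ^ (j + 1) - 1) - (q ^ (t + (j + 1)) - 1) * (q - 1)
      = q * (q ^ t - 1) * (q ^ j - 1) := by
    simp only [pow_add, pow_one]; ring
  have : 0 ≤ q * (q ^ t - 1) * (q ^ j - 1) :=
    mul_nonneg (mul_nonneg (by linarith) (by linarith)) (by linarith)
  linarith

theorem aux_cover [Fintype (Dual F V)] (𝓕 : Finset (Submodule F V)) (t : ℕ) (D : ℚ) (hD0 : 0 ≤ D)
    (hD : ∀ A : Submodule F V, finrank F A = t → ((𝓕.filter fun W => A ≤ W).card : ℚ) ≤ D)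
    (j : ℕ) :
    ∀ (S : Submodule F V), finrank F S = t + j →
    ((𝓕.filter fun W => t ≤ finrank F ↥(W ⊓ S)).card : ℚ) ≤
      ((((Fintype.card F : ℚ) ^ (t + 1) - 1)) / ((Fintype.card F : ℚ) - 1)) ^ j * D := by
  have hq := aux_one_lt (F := F)
  induction j with
  | zero =>
    intro S hS
    rw [pow_zero, one_mul]
    refine le_trans ?_ (hD S hS)
    norm_cast
    apply Finset.card_le_card
    intro W
    simp only [Finset.mem_filter]
    rintro ⟨h1, h2⟩
    refine ⟨h1, ?_⟩
    have := Submodule.eq_of_le_of_finrank_le (inf_le_right : W ⊓ S ≤ S) (by omega)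
    rw [← this]; exact inf_le_left
  | succ j ih =>
    intro S hS
    set q : ℚ := (Fintype.card F : ℚ) with hqdef
    set L := (q ^ (t + 1) - 1) / (q - 1) with hL
    have hL0 : 0 ≤ L := div_nonneg (sub_nonneg.2 (one_le_pow₀ hq.le)) (by linarith)
    have hSn := Submodule.finrank_le S
    have hSd := Subspace.finrank_add_finrank_dualAnnihilator_eq S
    obtain ⟨c, hc⟩ : ∃ c, finrank F V = t + (j + 1) + c := ⟨finrank F V - (t + (j+1)), by omega⟩
    have hSd' : finrank F S.dualAnnihilator = c := by omega
    have h := aux_double (𝓕.filter fun W => t ≤ finrank F ↥(W ⊓ S))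
      (Finset.univ.filter fun v : Dual F V => v ∈ (⊤ : Submodule F (Dual F V)) ∧
        v ∉ S.dualAnnihilator)
      (fun W v => t ≤ finrank F ↥(W ⊓ (S ⊓ LinearMap.ker v)))
      (q ^ (j + 1 + c) - q ^ c) (L ^ j * D) ?_ ?_
    · rw [aux_card_diff S.dualAnnihilator ⊤ le_top, finrank_top, Subspace.dual_finrank_eq, hSd', hc,
        ← hqdef] at h
      have hp : 0 < q ^ c := by positivity
      have hp2 : 0 < q ^ (j + 1) - 1 := sub_pos.2 (one_lt_pow₀ hq (by omega))
      have hX : 0 ≤ L ^ j * D := mul_nonneg (pow_nonneg hL0 _) hD0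
      have hr := aux_ratio q hq t j
      have hr2 : q ^ (t + (j + 1)) - 1 ≤ L * (q ^ (j + 1) - 1) := by
        rw [hL, div_mul_eq_mul_div, le_div_iff₀ (by linarith)]; exact hr
      rw [pow_succ, mul_assoc, mul_comm L, ← mul_assoc]
      refine le_of_mul_le_mul_left ?_ (mul_pos hp hp2)
      have h6 := mul_le_mul_of_nonneg_left (mul_le_mul_of_nonneg_right hr2 hX) hp.le
      rw [pow_add q (j + 1) c, pow_add q (t + (j + 1)) c] at h
      linarith
    · intro W hW
      simp only [Finset.mem_filter] at hW
      obtain ⟨T, hTW, hT⟩ := aux_exists_sub (W ⊓ S) t hW.2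
      have hTd := Subspace.finrank_add_finrank_dualAnnihilator_eq T
      have := aux_card_diff S.dualAnnihilator T.dualAnnihilator
        (Submodule.dualAnnihilator_anti (hTW.trans inf_le_right))
      rw [hSd', show finrank F T.dualAnnihilator = j + 1 + c by omega] at this
      rw [← this, Finset.filter_filter]
      norm_cast
      apply Finset.card_le_card
      intro v
      simp only [Finset.mem_filter, Finset.mem_univ, true_and, Submodule.mem_top]
      rintro ⟨h1, h2⟩
      refine ⟨h2, ?_⟩
      rw [← hT]
      apply Submodule.finrank_mono
      refine le_inf (hTW.trans inf_le_left) (le_inf (hTW.trans inf_le_right) ?_)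
      intro x hx
      exact (Submodule.mem_dualAnnihilator v).1 h1 x hx
    · intro v hv
      simp only [Finset.mem_filter, Finset.mem_univ, true_and, Submodule.mem_top] at hv
      have hSv : ¬ S ≤ LinearMap.ker v := fun h =>
        hv ((Submodule.mem_dualAnnihilator v).2 fun x hx => h hx)
      have hv0 : v ≠ 0 := by
        rintro rfl; exact hv (zero_mem _)
      have h1 := Module.Dual.finrank_ker_add_one_of_ne_zero hv0
      have h2 := Submodule.finrank_sup_add_finrank_inf_eq S (LinearMap.ker v)
      have h3 := Submodule.finrank_le (S ⊔ LinearMap.ker v)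
      have h4 : finrank F ↥(S ⊓ LinearMap.ker v) < finrank F S :=
        Submodule.finrank_lt_finrank_of_lt (lt_of_le_of_ne inf_le_left
          (fun h => hSv (inf_eq_left.1 h)))
      refine le_trans ?_ (ih (S ⊓ LinearMap.ker v) (by omega))
      norm_cast
      apply Finset.card_le_card
      intro W
      simp only [Finset.mem_filter]
      tauto

theorem aux_gauss_le (q : ℕ) (hq : 1 < q) (n k t : ℕ) (hkn : k ≤ n) (b : ℕ) (hb : t + b ≤ k) :
    gaussBinom q (n - (t + b)) (k - (t + b)) ≤
      ((q : ℚ) ^ k / (q : ℚ) ^ n) ^ b * gaussBinom q (n - t) (k - t) := by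
  have hq' : (1 : ℚ) < q := by exact_mod_cast hq
  induction b with
  | zero => simp
  | succ b ih =>
    refine le_trans ?_ (le_trans (mul_le_mul_of_nonneg_left (ih (by omega))
      (show 0 ≤ (q : ℚ) ^ k / (q : ℚ) ^ n by positivity)) (le_of_eq (by ring)))
    rw [aux_gauss_rec q n k (t + b) (by omega), ← mul_assoc, ← add_assoc]
    have hg := aux_gauss_nonneg q (n - (t + b + 1)) (k - (t + b + 1)) hq.le
    have : 1 ≤ (q : ℚ) ^ k / (q : ℚ) ^ n * (((q : ℚ) ^ (n - (t + b)) - 1) /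
        ((q : ℚ) ^ (k - (t + b)) - 1)) := by
      have hp2 : 0 < (q : ℚ) ^ (k - (t + b)) - 1 := sub_pos.2 (one_lt_pow₀ hq' (by omega))
      rw [div_mul_div_comm, one_le_div (by positivity), mul_sub, mul_sub, ← pow_add, ← pow_add,
        show n + (k - (t + b)) = k + (n - (t + b)) by omega]
      have := pow_le_pow_right₀ hq'.le hkn
      linarith
    nlinarith

/-- The smallest dimension of a `t`-cover. -/
theorem aux_min_cover (𝓕 : Finset (Submodule F V)) (t : ℕ)
    (hne : 𝓕.Nonempty) (C : Submodule F V) (hC : ∀ W ∈ 𝓕, t ≤ finrank F ↥(W ⊓ C)) :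
    ∃ a, t + a ≤ finrank F C ∧ (∃ S : Submodule F V, finrank F S = t + a ∧
      ∀ W ∈ 𝓕, t ≤ finrank F ↥(W ⊓ S)) ∧
      ∀ A : Submodule F V, finrank F A < t + a → ∃ G ∈ 𝓕, finrank F ↥(A ⊓ G) < t := by
  have hex : ∃ s, ∃ S : Submodule F V, finrank F S = s ∧ ∀ W ∈ 𝓕, t ≤ finrank F ↥(W ⊓ S) :=
    ⟨_, C, rfl, hC⟩
  obtain ⟨S, hS, hS2⟩ := Nat.find_spec hex
  obtain ⟨W, hW⟩ := hne
  have h1 : t ≤ Nat.find hex := by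
    rw [← hS]
    exact (hS2 W hW).trans (Submodule.finrank_mono inf_le_right)
  have h2 : Nat.find hex ≤ finrank F C := Nat.find_min' hex ⟨C, rfl, hC⟩
  refine ⟨Nat.find hex - t, by omega, ⟨S, by omega, hS2⟩, ?_⟩
  intro A hA
  by_contra hcon
  push Not at hcon
  exact Nat.find_min hex (m := finrank F A) (by omega)
    ⟨A, rfl, fun W hW => by rw [inf_comm]; exact hcon W hW⟩

theorem aux_one_side [Fintype V] [Fintype (Dual F V)] (𝓕 𝓖 : Finset (Submodule F V))
    (k l t a b : ℕ) (ht : 1 ≤ t) (htl : t ≤ l)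
    (hk : ∀ W ∈ 𝓕, finrank F W = k) (hkn : k ≤ finrank F V)
    (hl : ∀ W ∈ 𝓖, finrank F W = l)
    (hx : ∀ A ∈ 𝓕, ∀ B ∈ 𝓖, t ≤ finrank F ↥(A ⊓ B))
    (ha : ∃ S : Submodule F V, finrank F S = t + a ∧ ∀ W ∈ 𝓕, t ≤ finrank F ↥(W ⊓ S))
    (hbk : t + b ≤ k)
    (hb : ∀ A : Submodule F V, finrank F A < t + b → ∃ G ∈ 𝓖, finrank F ↥(A ⊓ G) < t) :
    (𝓕.card : ℚ) ≤
      ((((Fintype.card F : ℚ) ^ (t + 1) - 1)) / ((Fintype.card F : ℚ) - 1)) ^ a *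
      (((((Fintype.card F : ℚ) ^ (l - t + 1) - 1)) / ((Fintype.card F : ℚ) - 1)) ^ b *
      (((Fintype.card F : ℚ) ^ k / (Fintype.card F : ℚ) ^ finrank F V) ^ b *
        gaussBinom (Fintype.card F) (finrank F V - t) (k - t))) := by
  have hq := aux_one_lt (F := F)
  have hq' : 1 < Fintype.card F := Fintype.one_lt_card
  have hL : ∀ m, 0 ≤ ((Fintype.card F : ℚ) ^ m - 1) / ((Fintype.card F : ℚ) - 1) := fun m =>
    div_nonneg (sub_nonneg.2 (one_le_pow₀ hq.le)) (by linarith)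
  obtain ⟨S, hS, hS2⟩ := ha
  have hg := aux_gauss_nonneg (Fintype.card F) (finrank F V - t) (k - t) hq'.le
  have h := aux_cover 𝓕 t
    (((((Fintype.card F : ℚ) ^ (l - t + 1) - 1)) / ((Fintype.card F : ℚ) - 1)) ^ b *
      (((Fintype.card F : ℚ) ^ k / (Fintype.card F : ℚ) ^ finrank F V) ^ b *
        gaussBinom (Fintype.card F) (finrank F V - t) (k - t)))
    (mul_nonneg (pow_nonneg (hL _) _) (mul_nonneg (by positivity) hg)) ?_ a S hS
  · rwa [Finset.filter_true_of_mem hS2] at h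
  · intro A hA
    refine aux_branch 𝓕 𝓖 l t (t + b) _ ht htl hl hx hb ?_ b t A hA rfl
    intro B hB
    exact (aux_deg 𝓕 k hk hkn (k - (t + b)) (t + b) B hB (by omega)).trans
      (aux_gauss_le _ hq' _ _ _ hkn b hbk)

theorem aux_const (q : ℚ) (hq : 2 ≤ q) (n k l t : ℕ) (htk : t ≤ k) (ht : 1 ≤ t)
    (hn : k + l + t + 1 ≤ n) :
    ((q ^ (t + 1) - 1) / (q - 1)) * (((q ^ (k - t + 1) - 1) / (q - 1)) * (q ^ l / q ^ n)) ≤ 1 := by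
  have h0 : ∀ m, (q ^ m - 1) / (q - 1) ≤ q ^ m := fun m => by
    have := one_le_pow₀ (n := m) (show 1 ≤ q by linarith)
    rw [div_le_iff₀ (by linarith)]
    nlinarith
  have h1 : ∀ m, 0 ≤ (q ^ m - 1) / (q - 1) := fun m =>
    div_nonneg (sub_nonneg.2 (one_le_pow₀ (by linarith))) (by linarith)
  have hqp : 0 < q := by linarith
  calc _ ≤ q ^ (t + 1) * (q ^ (k - t + 1) * (q ^ l / q ^ n)) := by
        apply mul_le_mul (h0 _) _ (mul_nonneg (h1 _) (by positivity)) (by positivity)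
        exact mul_le_mul_of_nonneg_right (h0 _) (by positivity)
    _ = q ^ (t + 1 + (k - t + 1) + l) / q ^ n := by
        rw [pow_add, pow_add]; ring
    _ ≤ 1 := by
        rw [div_le_one (by positivity)]
        exact pow_le_pow_right₀ (by linarith) (by omega)

theorem aux_pair [Fintype V] [Fintype (Dual F V)] (𝓕 𝓖 : Finset (Submodule F V))
    (k l t : ℕ) (ht : 1 ≤ t) (htk : t ≤ k) (htl : t ≤ l)
    (hn : k + l + t + 1 ≤ finrank F V)
    (hk : ∀ W ∈ 𝓕, finrank F W = k)
    (hl : ∀ W ∈ 𝓖, finrank F W = l)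
    (hx : ∀ A ∈ 𝓕, ∀ B ∈ 𝓖, t ≤ finrank F ↥(A ⊓ B)) (hf : 𝓕.Nonempty) (hg : 𝓖.Nonempty) :
    (𝓕.card : ℚ) * (𝓖.card : ℚ) ≤
      gaussBinom (Fintype.card F) (finrank F V - t) (k - t) *
      gaussBinom (Fintype.card F) (finrank F V - t) (l - t) := by
  have hq2 : (2 : ℚ) ≤ (Fintype.card F : ℚ) := by exact_mod_cast Fintype.one_lt_card (α := F)
  have hx' : ∀ A ∈ 𝓖, ∀ B ∈ 𝓕, t ≤ finrank F ↥(A ⊓ B) := fun A hA B hB => by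
    rw [inf_comm]; exact hx B hB A hA
  obtain ⟨A0, hA0⟩ := id hf
  obtain ⟨B0, hB0⟩ := id hg
  obtain ⟨a, ha1, ha2, ha3⟩ := aux_min_cover 𝓕 t hf B0 (fun W hW => hx W hW B0 hB0)
  obtain ⟨b, hb1, hb2, hb3⟩ := aux_min_cover 𝓖 t hg A0 (fun W hW => hx' W hW A0 hA0)
  rw [hl B0 hB0] at ha1
  rw [hk A0 hA0] at hb1
  have h1 := aux_one_side 𝓕 𝓖 k l t a b ht htl hk (by omega) hl hx ha2 hb1 hb3
  have h2 := aux_one_side 𝓖 𝓕 l k t b a ht htk hl (by omega) hk hx' hb2 ha1 ha3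
  have c1 := aux_const _ hq2 (finrank F V) k l t htk ht hn
  have c2 := aux_const _ hq2 (finrank F V) l k t htl ht (by omega)
  have hL : ∀ m, 0 ≤ ((Fintype.card F : ℚ) ^ m - 1) / ((Fintype.card F : ℚ) - 1) := fun m =>
    div_nonneg (sub_nonneg.2 (one_le_pow₀ (by linarith))) (by linarith)
  have g1 := aux_gauss_nonneg (Fintype.card F) (finrank F V - t) (k - t) Fintype.card_pos
  have g2 := aux_gauss_nonneg (Fintype.card F) (finrank F V - t) (l - t) Fintype.card_pos
  have hm := mul_le_mul h1 h2 (by positivity) (le_trans (by positivity) h1)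
  refine hm.trans ?_
  have hqp : (0 : ℚ) < (Fintype.card F : ℚ) := by linarith
  generalize (Fintype.card F : ℚ) = q at *
  have p1 := pow_le_one₀ (n := a) (mul_nonneg (hL _) (mul_nonneg (hL _) (by positivity))) c1
  have p2 := pow_le_one₀ (n := b) (mul_nonneg (hL _) (mul_nonneg (hL _) (by positivity))) c2
  have p0 := pow_nonneg (mul_nonneg (hL (t + 1)) (mul_nonneg (hL (l - t + 1))
    (show 0 ≤ q ^ k / q ^ finrank F V by positivity))) b
  have p3 := mul_le_one₀ p1 p0 p2
  have p4 := mul_le_mul_of_nonneg_right p3 (mul_nonneg g1 g2)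
  rw [one_mul] at p4
  refine le_trans (le_of_eq ?_) p4
  simp only [mul_pow]
  ring

theorem aux_prod {r : ℕ} (hr : 2 ≤ r) (x y : Fin r → ℚ) (hx : ∀ i, 0 ≤ x i) (hy : ∀ i, 0 ≤ y i)
    (h : ∀ i j, i ≠ j → x i * x j ≤ y i * y j) : ∏ i, x i ≤ ∏ i, y i := by
  by_cases hall : ∀ i, x i ≤ y i
  · exact Finset.prod_le_prod (fun i _ => hx i) (fun i _ => hall i)
  push Not at hall
  obtain ⟨j, hj⟩ := hall
  have hxj : 0 < x j := lt_of_le_of_lt (hy j) hj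
  have hle : ∀ i, i ≠ j → x i ≤ y i := by
    intro i hi
    have h1 := h i j hi
    have h2 := mul_le_mul_of_nonneg_left hj.le (hy i)
    exact le_of_mul_le_mul_right (h1.trans h2) hxj
  have : Nontrivial (Fin r) := Fin.nontrivial_iff_two_le.2 hr
  obtain ⟨m, hm⟩ := exists_ne j
  have hmj : m ∈ Finset.univ.erase j := by simp [hm]
  rw [← Finset.mul_prod_erase _ x (Finset.mem_univ j), ← Finset.mul_prod_erase _ y (Finset.mem_univ j),
    ← Finset.mul_prod_erase _ x hmj, ← Finset.mul_prod_erase _ y hmj, ← mul_assoc, ← mul_assoc]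
  apply mul_le_mul (h j m hm.symm) _ (Finset.prod_nonneg fun i _ => hx i) (mul_nonneg (hy _) (hy _))
  apply Finset.prod_le_prod (fun i _ => hx i)
  intro i hi
  apply hle
  simp at hi
  exact hi.2

end Helpers

theorem stmt9 (q n t r : ℕ) (hr : 2 ≤ r) (k : Fin r → ℕ)
    (hmono : ∀ i j : Fin r, i ≤ j → k j ≤ k i) (hkt : ∀ i, t ≤ k i) (ht : 1 ≤ t)
    (hn : k ⟨0, by omega⟩ + k ⟨1, hr⟩ + t + 1 ≤ n)
    (F : Type*) [Field F] [Fintype F] (hF : Fintype.card F = q)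
    (V : Type*) [AddCommGroup V] [Module F V] [FiniteDimensional F V]
    (hV : Module.finrank F V = n)
    (𝓕 : Fin r → Set (Submodule F V))
    (hdim : ∀ i, ∀ W ∈ 𝓕 i, Module.finrank F W = k i)
    (hcross : ∀ f : (i : Fin r) → Submodule F V, (∀ i, f i ∈ 𝓕 i) →
      t ≤ Module.finrank F ↥(⨅ i, f i)) :
    (∏ i, ((𝓕 i).ncard : ℚ)) ≤ ∏ i, gaussBinom q (n - t) (k i - t) := by
  classical
  subst hF hV
  have : Finite V := Module.finite_of_finite F
  have : Finite (Module.Dual F V) := Module.finite_of_finite F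
  have : Finite (Submodule F V) := Finite.of_injective (fun S => (S : Set V)) SetLike.coe_injective
  have : Fintype V := Fintype.ofFinite V
  have : Fintype (Module.Dual F V) := Fintype.ofFinite _
  have hg : ∀ i, 0 ≤ gaussBinom (Fintype.card F) (Module.finrank F V - t) (k i - t) := fun i =>
    aux_gauss_nonneg _ _ _ Fintype.card_pos
  by_cases hne : ∀ i, (𝓕 i).Nonempty
  swap
  · push Not at hne
    obtain ⟨i, hi⟩ := hne
    rw [Finset.prod_eq_zero (Finset.mem_univ i) (by simp [hi])]
    exact Finset.prod_nonneg fun i _ => hg i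
  apply aux_prod hr _ _ (fun i => by positivity) hg
  have main : ∀ i j : Fin r, i < j → ((𝓕 i).ncard : ℚ) * ((𝓕 j).ncard : ℚ) ≤
      gaussBinom (Fintype.card F) (Module.finrank F V - t) (k i - t) *
      gaussBinom (Fintype.card F) (Module.finrank F V - t) (k j - t) := by
    intro i j hij
    have hki : k i ≤ k ⟨0, by omega⟩ := hmono _ _ (Fin.mk_le_of_le_val (Nat.zero_le _))
    have hkj : k j ≤ k ⟨1, hr⟩ := hmono _ _ (Fin.mk_le_of_le_val (by
      have : i.val < j.val := hij
      omega))
    rw [Set.ncard_eq_toFinset_card _ (Set.toFinite (𝓕 i)),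
      Set.ncard_eq_toFinset_card _ (Set.toFinite (𝓕 j))]
    choose w hw using hne
    apply aux_pair _ _ (k i) (k j) t ht (hkt i) (hkt j) (by omega)
    · intro W hW
      exact hdim i W (by simpa using hW)
    · intro W hW
      exact hdim j W (by simpa using hW)
    · intro A hA B hB
      have hA : A ∈ 𝓕 i := by simpa using hA
      have hB : B ∈ 𝓕 j := by simpa using hB
      have h := hcross (Function.update (Function.update w i A) j B) (by
        intro m
        by_cases hmj : m = j
        · subst hmj; simpa using hB
        · by_cases hmi : m = i
          · subst hmi; simpa [hmj] using hA
          · simpa [hmj, hmi] using hw m)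
      refine h.trans (Submodule.finrank_mono (le_inf ?_ ?_))
      · refine (iInf_le _ i).trans (le_of_eq ?_)
        simp [hij.ne]
      · refine (iInf_le _ j).trans (le_of_eq ?_)
        simp
    · exact ⟨w i, by simpa using hw i⟩
    · exact ⟨w j, by simpa using hw j⟩
  intro i j hij
  rcases lt_or_gt_of_ne hij with h | h
  · exact main i j h
  · have := main j i h
    linarith
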